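/- arXiv:1410.3175 — 3 statements merged into one kernel-verified Lean document; each statement's English description precedes it below -/
import Mathlib

section
/- Suppose a ∈ ℂ with a ≠ 0 and z₀ ∈ ℂ with z₀² + 2z₀ ≠ 0 satisfy a/(z₀² + 2z₀) = z₀ (so z₀ is a fixed point of R_a), and let λ = −a(2z₀ + 2)/(z₀² + 2z₀)² be the multiplier of this fixed point. Then λ ≠ −2 and a·(2 + λ)³ = 8·(1 + λ)². In particular, the parameter a is uniquely determined by the multiplier λ of a finite fixed point of R_a. -/
theorem basilica_aux (a z lam : ℂ) (hden : z ^ 2 + 2 * z ≠ 0)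
    (hfix : a / (z ^ 2 + 2 * z) = z)
    (hlam : lam = -a * (2 * z + 2) / (z ^ 2 + 2 * z) ^ 2) :
    lam ≠ -2 ∧ a * (2 + lam) ^ 3 = 8 * (1 + lam) ^ 2 := by
  have ha : a = z * (z ^ 2 + 2 * z) := by
    rwa [div_eq_iff hden] at hfix
  have hz : z ≠ 0 := by
    rintro rfl
    simp at hden
  have hz2 : z + 2 ≠ 0 := by
    intro h
    apply hden
    linear_combination z * h
  have hl : lam = -(2 * z + 2) / (z + 2) := by
    rw [hlam, div_eq_div_iff (pow_ne_zero 2 hden) hz2, ha]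
    ring
  constructor
  · intro h
    rw [hl, div_eq_iff hz2] at h
    have h2 : (2 : ℂ) = 0 := by linear_combination h
    norm_num at h2
  · have h1 : 2 + lam = 2 / (z + 2) := by
      rw [hl]
      field_simp
      ring
    have h2 : 1 + lam = -z / (z + 2) := by
      rw [hl]
      field_simp
      ring
    rw [h1, h2, ha]
    field_simp
    ring

/-- If `z₀` is a finite fixed point of `R_a(z) = a/(z² + 2z)` (with `a ≠ 0`) and
`λ = −a(2z₀ + 2)/(z₀² + 2z₀)²` is its multiplier, then `λ ≠ −2` and
`a (2 + λ)³ = 8 (1 + λ)²`; in particular `a` is uniquely determined by `λ`. -/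
theorem basilica_param_determined_by_multiplier (a z₀ : ℂ) (ha : a ≠ 0)
    (hden : z₀ ^ 2 + 2 * z₀ ≠ 0)
    (hfix : a / (z₀ ^ 2 + 2 * z₀) = z₀)
    (lam : ℂ) (hlam : lam = -a * (2 * z₀ + 2) / (z₀ ^ 2 + 2 * z₀) ^ 2) :
    lam ≠ -2 ∧ a * (2 + lam) ^ 3 = 8 * (1 + lam) ^ 2 ∧
    (∀ a' z₀' : ℂ, a' ≠ 0 → z₀' ^ 2 + 2 * z₀' ≠ 0 →
      a' / (z₀' ^ 2 + 2 * z₀') = z₀' →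
      lam = -a' * (2 * z₀' + 2) / (z₀' ^ 2 + 2 * z₀') ^ 2 → a' = a) := by
  obtain ⟨h1, h2⟩ := basilica_aux a z₀ lam hden hfix hlam
  refine ⟨h1, h2, ?_⟩
  intro a' z' _ hd hf hl
  obtain ⟨_, h3⟩ := basilica_aux a' z' lam hd hf hl
  have h4 : (2 + lam) ^ 3 ≠ 0 := by
    apply pow_ne_zero
    intro h
    apply h1
    linear_combination h
  exact mul_right_cancel₀ h4 (h3.trans h2.symm)
end

section
/- Let r > 0 and θ ∈ ℝ, and let a, b ∈ ℂ satisfy a + b = 3 − r e^{−iθ} and a b = r e^{iθ} (i.e. a and b are the two roots of z² + (r e^{−iθ} − 3) z + r e^{iθ} = 0), with a ≠ 1 and b ≠ 1. Then the Blaschke-type product F(z) = −e^{−iθ} z(z − a)(z − b)/((1 − \bar{a} z)(1 − \bar{b} z)) has a double critical point at 1: F′(1) = 0 and F″(1) = 0. -/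
open ComplexConjugate

/-- If `a` and `b` are the two roots of `z² + (r e^{−iθ} − 3) z + r e^{iθ} = 0`
(i.e. `a + b = 3 − r e^{−iθ}` and `a b = r e^{iθ}`), with `a ≠ 1` and `b ≠ 1`, then the
Blaschke-type product `F(z) = −e^{−iθ} z(z − a)(z − b)/((1 − ā z)(1 − b̄ z))` has a
double critical point at `1`: `F′(1) = 0` and `F″(1) = 0`. -/
theorem blaschke_double_critical_point_at_one (r θ : ℝ) (hr : 0 < r) (a b : ℂ)
    (hsum : a + b = 3 - (r : ℂ) * Complex.exp (-(θ : ℂ) * Complex.I))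
    (hprod : a * b = (r : ℂ) * Complex.exp ((θ : ℂ) * Complex.I))
    (ha : a ≠ 1) (hb : b ≠ 1)
    (F : ℂ → ℂ)
    (hF : F = fun z : ℂ => -Complex.exp (-(θ : ℂ) * Complex.I) *
      (z * (z - a) * (z - b)) / ((1 - conj a * z) * (1 - conj b * z))) :
    deriv F 1 = 0 ∧ deriv (deriv F) 1 = 0 := by
  have hs : conj a + conj b = 3 - a * b := by
    rw [hprod, ← map_add, hsum]
    simp [← Complex.exp_conj]
    exact Complex.conj_ofNat 3
  have hp : conj a * conj b = 3 - (a + b) := by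
    rw [hsum, ← map_mul, hprod]
    simp [← Complex.exp_conj]
  set c : ℂ := -Complex.exp (-(θ : ℂ) * Complex.I) with hc
  have hD : ∀ z : ℂ, (1 - conj a * z) * (1 - conj b * z)
      = 1 - (3 - a * b) * z + (3 - (a + b)) * z ^ 2 := by
    intro z
    rw [← hs, ← hp]; ring
  have hne : ∀ w : ℂ, w ≠ 1 → 1 - conj w * 1 ≠ 0 := by
    intro w hw h
    apply hw
    have h2 : conj w = 1 := by linear_combination -h
    simpa using congrArg conj h2
  have hD1 : (1 : ℂ) - (3 - a * b) * 1 + (3 - (a + b)) * 1 ^ 2 ≠ 0 := by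
    rw [← hD]
    exact mul_ne_zero (hne a ha) (hne b hb)
  have hF' : F = fun z : ℂ => c * (z * (z - a) * (z - b)) /
      (1 - (3 - a * b) * z + (3 - (a + b)) * z ^ 2) := by
    rw [hF]; funext z; rw [hD]
  let D : ℂ → ℂ := fun z => 1 - (3 - a * b) * z + (3 - (a + b)) * z ^ 2
  let h : ℂ → ℂ := fun z =>
    c * (3 * D z - (z - 1) * (-(3 - a * b) + 2 * (3 - (a + b)) * z)) / (D z) ^ 2
  have hDd : ∀ z, HasDerivAt D (-(3 - a * b) + 2 * (3 - (a + b)) * z) z := by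
    intro z
    have := (((hasDerivAt_id z).const_mul (3 - a * b)).const_sub 1).add
      ((hasDerivAt_pow 2 z).const_mul (3 - (a + b)))
    refine this.congr_deriv ?_
    norm_num
    ring
  have hDc : Differentiable ℂ D := fun z => (hDd z).differentiableAt
  have hFd : ∀ z, D z ≠ 0 → HasDerivAt F ((z - 1) ^ 2 * h z) z := by
    intro z hz
    have hN : HasDerivAt (fun z : ℂ => c * (D z + (z - 1) ^ 3))
        (c * ((-(3 - a * b) + 2 * (3 - (a + b)) * z) + 3 * (z - 1) ^ 2)) z := by
      have := ((hDd z).add (((hasDerivAt_id z).sub_const 1).pow 3)).const_mul c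
      refine this.congr_deriv ?_
      norm_num
    have hq := hN.div (hDd z) hz
    have hFe : F = (fun z : ℂ => c * (D z + (z - 1) ^ 3)) / D := by
      rw [hF']; funext w
      simp only [Pi.div_apply, D]
      congr 2
      ring
    rw [hFe]
    refine hq.congr_deriv ?_
    simp only [h]
    field_simp
    ring
  have hev : deriv F =ᶠ[nhds 1] fun z => (z - 1) ^ 2 * h z := by
    filter_upwards [hDc.continuous.continuousAt.eventually_ne hD1] with z hz
    exact (hFd z hz).deriv
  refine ⟨by rw [(hFd 1 hD1).deriv]; simp, ?_⟩
  rw [hev.deriv_eq]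
  have hh : DifferentiableAt ℂ h 1 := by
    have h2 : D 1 ^ 2 ≠ 0 := pow_ne_zero 2 hD1
    have h3 := hDc 1
    refine DifferentiableAt.div ?_ (h3.pow 2) h2
    fun_prop
  have h4 := (((hasDerivAt_id (1 : ℂ)).sub_const 1).pow 2).mul hh.hasDerivAt
  refine (h4.congr_deriv ?_).deriv
  simp
end

section
/- For ε > 0 define the wedge V⁺_ε = { ρ e^{2πit} : 0 ≤ ρ ≤ ε, 3/16 ≤ t ≤ 5/16 } ⊂ ℂ and V⁻_ε = −V⁺_ε. There exists δ > 0 such that for every real r with 1 < r < 1 + δ there exists ε > 0 such that the map G(z) = r² z (1 + z²) satisfies G(V⁺_ε) ⊆ V⁺_ε and G(V⁻_ε) ⊆ V⁻_ε. -/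
/-- The wedge `V⁺_ε = { ρ e^{2πit} : 0 ≤ ρ ≤ ε, 3/16 ≤ t ≤ 5/16 }`. -/
def Vplus (ε : ℝ) : Set ℂ :=
  {z : ℂ | ∃ ρ t : ℝ, 0 ≤ ρ ∧ ρ ≤ ε ∧ 3 / 16 ≤ t ∧ t ≤ 5 / 16 ∧
    z = (ρ : ℂ) * Complex.exp (2 * Real.pi * t * Complex.I)}

/-- The opposite wedge `V⁻_ε = −V⁺_ε`. -/
def Vminus (ε : ℝ) : Set ℂ := {z : ℂ | -z ∈ Vplus ε}

open Real in
lemma sin_cos_eighth : 0 < sin (π / 8) ∧ 0 < cos (π / 8) ∧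
    5 * sin (π / 8) ^ 2 ≤ cos (π / 8) ^ 2 := by
  have hp := Real.pi_pos
  refine ⟨sin_pos_of_pos_of_lt_pi (by linarith) (by linarith),
    cos_pos_of_mem_Ioo ⟨by linarith, by linarith⟩, ?_⟩
  have h1 : cos (π / 4) = 2 * cos (π / 8) ^ 2 - 1 := by
    rw [← cos_two_mul]; congr 1; ring
  have h2 := sin_sq_add_cos_sq (π / 8)
  rw [cos_pi_div_four] at h1
  have h3 : (1.4 : ℝ) ≤ √2 := by
    apply Real.le_sqrt_of_sq_le; norm_num
  nlinarith

open Real in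
lemma sin_sub_eighth (α : ℝ) :
    sin (α - 3 * π / 8) = sin α * sin (π / 8) - cos α * cos (π / 8) := by
  have : α - 3 * π / 8 = (α + π / 8) - π / 2 := by ring
  rw [this, sin_sub_pi_div_two, cos_add]; ring

open Real in
lemma sin_eighth_sub (α : ℝ) :
    sin (5 * π / 8 - α) = sin α * sin (π / 8) + cos α * cos (π / 8) := by
  have : 5 * π / 8 - α = π / 2 - (α - π / 8) := by ring
  rw [this, sin_pi_div_two_sub, cos_sub]; ring

open Real in
lemma mem_Vplus_iff {ε : ℝ} (hε : 0 < ε) (z : ℂ) : z ∈ Vplus ε ↔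
    0 ≤ z.im ∧ z.re * cos (π / 8) ≤ z.im * sin (π / 8) ∧
    -(z.re * cos (π / 8)) ≤ z.im * sin (π / 8) ∧ z.re ^ 2 + z.im ^ 2 ≤ ε ^ 2 := by
  obtain ⟨ha, hb, hab⟩ := sin_cos_eighth
  have hp := Real.pi_pos
  constructor
  · rintro ⟨ρ, t, h0, h1, h2, h3, rfl⟩
    have e : (2 * Real.pi * t * Complex.I : ℂ) = ((2 * π * t : ℝ) : ℂ) * Complex.I := by
      push_cast; ring
    rw [e]
    have hre : ((ρ : ℂ) * Complex.exp (((2 * π * t : ℝ) : ℂ) * Complex.I)).re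
        = ρ * cos (2 * π * t) := by
      rw [Complex.re_ofReal_mul, Complex.exp_ofReal_mul_I_re]
    have him : ((ρ : ℂ) * Complex.exp (((2 * π * t : ℝ) : ℂ) * Complex.I)).im
        = ρ * sin (2 * π * t) := by
      rw [Complex.im_ofReal_mul, Complex.exp_ofReal_mul_I_im]
    rw [hre, him]
    have l1 : 3 * π / 8 ≤ 2 * π * t := by nlinarith
    have l2 : 2 * π * t ≤ 5 * π / 8 := by nlinarith
    generalize 2 * π * t = α at *
    have s0 : 0 ≤ sin α := sin_nonneg_of_nonneg_of_le_pi (by linarith) (by linarith)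
    have s1 : 0 ≤ sin (α - 3 * π / 8) :=
      sin_nonneg_of_nonneg_of_le_pi (by linarith) (by linarith)
    have s2 : 0 ≤ sin (5 * π / 8 - α) :=
      sin_nonneg_of_nonneg_of_le_pi (by linarith) (by linarith)
    rw [sin_sub_eighth] at s1
    rw [sin_eighth_sub] at s2
    refine ⟨by positivity, ?_, ?_, ?_⟩
    · nlinarith [mul_nonneg h0 s1]
    · nlinarith [mul_nonneg h0 s2]
    · have := sin_sq_add_cos_sq α
      have e2 : (ρ * cos α) ^ 2 + (ρ * sin α) ^ 2 = ρ ^ 2 := by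
        linear_combination ρ ^ 2 * this
      rw [e2]; gcongr
  · rintro ⟨h0, h1, h2, h3⟩
    rcases h0.eq_or_lt with h0 | h0
    · rw [← h0] at h1 h2
      have hx : z.re = 0 := by
        have : z.re * cos (π / 8) = 0 := by linarith
        rcases mul_eq_zero.1 this with h | h
        · exact h
        · exact absurd h hb.ne'
      have hz : z = 0 := Complex.ext hx h0.symm
      exact ⟨0, 1 / 4, le_rfl, hε.le, by norm_num, by norm_num, by simp [hz]⟩
    · have hz : z ≠ 0 := by rintro rfl; simp at h0
      have hn : 0 < ‖z‖ := norm_pos_iff.2 hz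
      have hre : ‖z‖ * cos z.arg = z.re := Complex.norm_mul_cos_arg z
      have him : ‖z‖ * sin z.arg = z.im := Complex.norm_mul_sin_arg z
      have a0 : 0 ≤ z.arg := Complex.arg_nonneg_iff.2 h0.le
      have a1 : z.arg ≤ π := Complex.arg_le_pi z
      have s1 : 0 ≤ sin (z.arg - 3 * π / 8) := by
        rw [sin_sub_eighth]
        refine nonneg_of_mul_nonneg_right (?_ : 0 ≤ ‖z‖ * _) hn
        rw [← hre, ← him] at h1
        linarith
      have s2 : 0 ≤ sin (5 * π / 8 - z.arg) := by
        rw [sin_eighth_sub]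
        refine nonneg_of_mul_nonneg_right (?_ : 0 ≤ ‖z‖ * _) hn
        rw [← hre, ← him] at h2
        linarith
      have b1 : 3 * π / 8 ≤ z.arg := by
        by_contra! h
        have := sin_neg_of_neg_of_neg_pi_lt (x := z.arg - 3 * π / 8)
          (by linarith) (by linarith)
        linarith
      have b2 : z.arg ≤ 5 * π / 8 := by
        by_contra! h
        have := sin_neg_of_neg_of_neg_pi_lt (x := 5 * π / 8 - z.arg)
          (by linarith) (by linarith)
        linarith
      refine ⟨‖z‖, z.arg / (2 * π), hn.le, ?_, ?_, ?_, ?_⟩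
      · refine (sq_le_sq₀ hn.le hε.le).1 ?_
        rw [Complex.sq_norm, Complex.normSq_apply]; linarith
      · rw [le_div_iff₀ (by positivity)]; linarith
      · rw [div_le_iff₀ (by positivity)]; linarith
      · have e : (2 * Real.pi * ((z.arg / (2 * π) : ℝ) : ℂ) * Complex.I : ℂ)
            = (z.arg : ℂ) * Complex.I := by
          have : (π : ℂ) ≠ 0 := by exact_mod_cast hp.ne'
          push_cast; field_simp
        rw [e, Complex.norm_mul_exp_arg_mul_I]

lemma Vplus_invariant (r : ℝ) (h1 : 1 < r) (h2 : r < 1 + 1 / 20) (z : ℂ)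
    (hz : z ∈ Vplus (1 / 2)) : (r : ℂ) ^ 2 * z * (1 + z ^ 2) ∈ Vplus (1 / 2) := by
  rw [mem_Vplus_iff (by norm_num)] at hz ⊢
  obtain ⟨ha, hb, hab⟩ := sin_cos_eighth
  generalize Real.sin (Real.pi / 8) = a at *
  generalize Real.cos (Real.pi / 8) = b at *
  have hre : ((r : ℂ) ^ 2 * z * (1 + z ^ 2)).re
      = r ^ 2 * (z.re * (1 + z.re ^ 2 - 3 * z.im ^ 2)) := by
    simp [pow_two]; ring
  have him : ((r : ℂ) ^ 2 * z * (1 + z ^ 2)).im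
      = r ^ 2 * (z.im * (1 + 3 * z.re ^ 2 - z.im ^ 2)) := by
    simp [pow_two]; ring
  rw [hre, him]
  generalize z.re = x at *
  generalize z.im = y at *
  obtain ⟨k0, k1, k2, k3⟩ := hz
  have hr : 0 ≤ r ^ 2 := by positivity
  have hA : 0 ≤ 1 + x ^ 2 - 3 * y ^ 2 := by nlinarith [sq_nonneg x]
  have hAB : 0 ≤ (1 + 3 * x ^ 2 - y ^ 2) - (1 + x ^ 2 - 3 * y ^ 2) := by
    nlinarith [sq_nonneg x, sq_nonneg y]
  have hya : 0 ≤ y * a := by positivity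
  have q := mul_nonneg hya hAB
  refine ⟨?_, ?_, ?_, ?_⟩
  · exact mul_nonneg hr (mul_nonneg k0 (by linarith))
  · have := mul_le_mul_of_nonneg_right k1 hA
    have : x * (1 + x ^ 2 - 3 * y ^ 2) * b ≤ y * (1 + 3 * x ^ 2 - y ^ 2) * a := by linarith
    nlinarith [mul_le_mul_of_nonneg_left this hr]
  · have := mul_le_mul_of_nonneg_right k2 hA
    have : -(x * (1 + x ^ 2 - 3 * y ^ 2) * b) ≤ y * (1 + 3 * x ^ 2 - y ^ 2) * a := by linarith
    nlinarith [mul_le_mul_of_nonneg_left this hr]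
  · have hxy : 5 * x ^ 2 ≤ y ^ 2 := by
      have h : (x * b) ^ 2 ≤ (y * a) ^ 2 := sq_le_sq' (by linarith) k1
      have h' : b ^ 2 * (5 * x ^ 2) ≤ b ^ 2 * y ^ 2 := by
        nlinarith [mul_le_mul_of_nonneg_left hab (sq_nonneg y)]
      exact le_of_mul_le_mul_left h' (by positivity)
    have hr4 : r ^ 4 ≤ 5 / 4 := by
      calc r ^ 4 ≤ (1 + 1 / 20) ^ 4 := by gcongr
        _ ≤ _ := by norm_num
    set s := x ^ 2 + y ^ 2 with hs
    have s0 : 0 ≤ s := by positivity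
    have e : (r ^ 2 * (x * (1 + x ^ 2 - 3 * y ^ 2))) ^ 2 +
        (r ^ 2 * (y * (1 + 3 * x ^ 2 - y ^ 2))) ^ 2 =
        r ^ 4 * (s * (1 + 2 * (x ^ 2 - y ^ 2) + s ^ 2)) := by rw [hs]; ring
    have u1 : s * (1 + 2 * (x ^ 2 - y ^ 2) + s ^ 2) ≤ s * (1 - 4 / 3 * s + s ^ 2) := by
      apply mul_le_mul_of_nonneg_left _ s0
      linarith
    have u2 : s * (1 - 4 / 3 * s + s ^ 2) ≤ 1 / 5 := by
      have : s ≤ 1 / 4 := by linarith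
      nlinarith [mul_nonneg s0 (sub_nonneg.2 this), mul_nonneg (mul_nonneg s0 s0) (sub_nonneg.2 this)]
    rw [e]
    calc r ^ 4 * (s * (1 + 2 * (x ^ 2 - y ^ 2) + s ^ 2)) ≤ r ^ 4 * (1 / 5) := by
          apply mul_le_mul_of_nonneg_left _ (by positivity); linarith
      _ ≤ (1 / 2) ^ 2 := by linarith

/-- There exists `δ > 0` such that for every real `r` with `1 < r < 1 + δ` there is
`ε > 0` for which the map `G(z) = r² z (1 + z²)` maps each of the wedges `V⁺_ε` and
`V⁻_ε` into itself. -/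
theorem wedges_invariant_under_model_map :
    ∃ δ > (0 : ℝ), ∀ r : ℝ, 1 < r → r < 1 + δ →
      ∃ ε > (0 : ℝ),
        (∀ z ∈ Vplus ε, (r : ℂ) ^ 2 * z * (1 + z ^ 2) ∈ Vplus ε) ∧
        (∀ z ∈ Vminus ε, (r : ℂ) ^ 2 * z * (1 + z ^ 2) ∈ Vminus ε) := by
  refine ⟨1 / 20, by norm_num, fun r h1 h2 => ⟨1 / 2, by norm_num,
    fun z hz => Vplus_invariant r h1 h2 z hz, fun z hz => ?_⟩⟩
  have h := Vplus_invariant r h1 h2 (-z) hz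
  have e : (r : ℂ) ^ 2 * (-z) * (1 + (-z) ^ 2) = -((r : ℂ) ^ 2 * z * (1 + z ^ 2)) := by ring
  rw [e] at h
  exact h
end
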